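/- For all real α, β with 0 ≤ α ≤ 1 and 0 ≤ β ≤ 1 and all real k ≥ 0, l ≥ 0, one has l²·β²·Θ₀(α,β) + k·l·α·β·Θ₁(α,β) + k²·α²·Θ₂(α,β) ≥ 0. (This is the quantity whose negative gives the sign of the boundary derivative in the proof of Lemma 4.2, showing the derivative of (k√(Z₁Z₂)+l√(Z₁Z₃)+(k+l)√(Z₂Z₃))Z₄ is non-positive on the boundary of 𝒟⁻.) -/

import Mathlib

/-- Θ₀(α,β) = (α+1)²β² + (α−1)(2α²+3α+2)β + (α²−1)². -/
def Θ₀ (α β : ℝ) : ℝ := (α+1)^2*β^2 + (α-1)*(2*α^2+3*α+2)*β + (α^2-1)^2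

/-- Θ₁(α,β) = 2αβ(α+β)² + (α+β)(2α² − αβ + 2β²) − (α+β)² − (α+β) + 2. -/
def Θ₁ (α β : ℝ) : ℝ :=
  2*α*β*(α+β)^2 + (α+β)*(2*α^2 - α*β + 2*β^2) - (α+β)^2 - (α+β) + 2

/-- Θ₂(α,β) = (β+1)²α² + (β−1)(2β²+3β+2)α + (β²−1)². -/
def Θ₂ (α β : ℝ) : ℝ := (β+1)^2*α^2 + (β-1)*(2*β^2+3*β+2)*α + (β^2-1)^2

theorem Θ₀_nonneg {α : ℝ} (hα : 0 ≤ α) (β : ℝ) : 0 ≤ Θ₀ α β := by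
  have hpos : 0 < 4 * (α + 1) ^ 2 := by positivity
  have h : 4 * (α + 1) ^ 2 * Θ₀ α β =
      (2 * (α + 1) ^ 2 * β + (α - 1) * (2 * α ^ 2 + 3 * α + 2)) ^ 2 +
        (α - 1) ^ 2 * (α * (4 * α ^ 2 + 7 * α + 4)) := by
    unfold Θ₀
    ring
  refine nonneg_of_mul_nonneg_right ?_ hpos
  rw [h]
  positivity

theorem Θ₂_eq_Θ₀_swap (α β : ℝ) : Θ₂ α β = Θ₀ β α := rfl

theorem Θ₁_nonneg {α β : ℝ} (hα0 : 0 ≤ α) (hα1 : α ≤ 1) (hβ0 : 0 ≤ β) (hβ1 : β ≤ 1) :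
    0 ≤ Θ₁ α β := by
  obtain ⟨s, hs⟩ : ∃ s, s = α + β := ⟨_, rfl⟩
  have hs0 : 0 ≤ s := by linarith
  have hs2 : s ≤ 2 := by linarith
  have h : Θ₁ α β = s * (5 - 2 * s) * (α - β) ^ 2 / 4 +
      (s ^ 4 / 2 + 3 / 4 * s ^ 3 - s ^ 2 - s + 2) := by
    unfold Θ₁
    rw [hs]
    ring
  have h_diff : 0 ≤ s * (5 - 2 * s) * (α - β) ^ 2 / 4 := by
    have : 0 ≤ 5 - 2 * s := by linarith
    positivity
  have h_quartic : 0 ≤ s ^ 4 / 2 + 3 / 4 * s ^ 3 - s ^ 2 - s + 2 := by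
    nlinarith [sq_nonneg (s ^ 2 - 1), sq_nonneg (s - 1), mul_nonneg hs0 (sq_nonneg (s - 1))]
  rw [h]
  exact add_nonneg h_diff h_quartic

/-- The key non-negativity in the proof of Lemma 4.2: the boundary derivative of
(k√(Z₁Z₂)+l√(Z₁Z₃)+(k+l)√(Z₂Z₃))Z₄ is non-positive on the boundary of 𝒟⁻. -/
theorem Theta_combination_nonneg (α β k l : ℝ)
    (hα0 : 0 ≤ α) (hα1 : α ≤ 1) (hβ0 : 0 ≤ β) (hβ1 : β ≤ 1)
    (hk : 0 ≤ k) (hl : 0 ≤ l) :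
    0 ≤ l^2 * β^2 * Θ₀ α β + k * l * α * β * Θ₁ α β + k^2 * α^2 * Θ₂ α β := by
  have h₀ := Θ₀_nonneg hα0 β
  have h₁ := Θ₁_nonneg hα0 hα1 hβ0 hβ1
  have h₂ : 0 ≤ Θ₂ α β := Θ₂_eq_Θ₀_swap α β ▸ Θ₀_nonneg hβ0 α
  positivity
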